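/- Let G be an abelian group, α, β ∈ G, and let λ be a partition of [n] with k ≥ 1 blocks. Then s_{α,β}(λ^{0,0}) = s_{α,β}(λ^{0,1}) = s_{α,β}(λ), and s_{α,β}(λ^{0,j}) = s_{α,β}(λ^{j−1}) for 2 ≤ j ≤ k+1. Moreover, for every 1 ≤ i ≤ k: s_{α,β}(λ^{i,0}) = s_{α,β}(λ^{i,1}) = s_{α,β}(λ^{i}); s_{α,β}(λ^{i,j}) = s_{α,β}(λ^{i}) + s_{α,β}(λ^{j−1}) − s_{α,β}(λ^{1}) + α for 2 ≤ j ≤ i; and s_{α,β}(λ^{i,j}) = s_{α,β}(λ^{i}) + s_{α,β}(λ^{j}) − s_{α,β}(λ^{1}) + β for i+1 ≤ j ≤ k. -/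

import Mathlib

open Finset

/-- A set partition of `[n] = {1,…,n}`, modeled as a `Finpartition` of `Fin n`. -/
abbrev SetPartition (n : ℕ) := Finpartition (Finset.univ : Finset (Fin n))

/-- `(i,j)` is an arc of the partition `p`: `i < j`, they lie in a common block,
and no element of that block lies strictly between them. -/
def IsArc {n : ℕ} (p : SetPartition n) (i j : Fin n) : Prop :=
  i < j ∧ ∃ B ∈ p.parts, i ∈ B ∧ j ∈ B ∧ ∀ x ∈ B, ¬ (i < x ∧ x < j)

/-- Arcs `a = (i₁,j₁)` and `b = (i₂,j₂)` form a crossing: `i₁ < i₂ < j₁ < j₂`. -/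
def Crossing {n : ℕ} (a b : Fin n × Fin n) : Prop :=
  a.1 < b.1 ∧ b.1 < a.2 ∧ a.2 < b.2

/-- Arcs `a = (i₁,j₁)` and `b = (i₂,j₂)` form a nesting: `i₁ < i₂ < j₂ < j₁`. -/
def Nesting {n : ℕ} (a b : Fin n × Fin n) : Prop :=
  a.1 < b.1 ∧ b.1 < b.2 ∧ b.2 < a.2

/-- `cr p`: the number of crossings of two arcs in `p`. -/
noncomputable def cr {n : ℕ} (p : SetPartition n) : ℕ :=
  {e : (Fin n × Fin n) × (Fin n × Fin n) |
    IsArc p e.1.1 e.1.2 ∧ IsArc p e.2.1 e.2.2 ∧ Crossing e.1 e.2}.ncard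

/-- `ne' p`: the number of nestings of two arcs in `p`. -/
noncomputable def ne' {n : ℕ} (p : SetPartition n) : ℕ :=
  {e : (Fin n × Fin n) × (Fin n × Fin n) |
    IsArc p e.1.1 e.1.2 ∧ IsArc p e.2.1 e.2.2 ∧ Nesting e.1 e.2}.ncard

/-- `al p`: the number of alignments (unordered pairs of arcs that neither
cross nor nest, counted with first endpoints in increasing order). -/
noncomputable def al {n : ℕ} (p : SetPartition n) : ℕ :=
  {e : (Fin n × Fin n) × (Fin n × Fin n) |
    IsArc p e.1.1 e.1.2 ∧ IsArc p e.2.1 e.2.2 ∧ e.1.1 < e.2.1 ∧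
    ¬ Crossing e.1 e.2 ∧ ¬ Crossing e.2 e.1 ∧
    ¬ Nesting e.1 e.2 ∧ ¬ Nesting e.2 e.1}.ncard

/-- `i` and `j` lie in a common block of `p`. -/
def InSameBlock {n : ℕ} (p : SetPartition n) (i j : Fin n) : Prop :=
  ∃ B ∈ p.parts, i ∈ B ∧ j ∈ B

/-- `c` (a partition of `[n+1]`) is a child of `p` (a partition of `[n]`):
deleting the element `1` from `c` and shifting down by one yields `p`. -/
def IsChild {n : ℕ} (c : SetPartition (n + 1)) (p : SetPartition n) : Prop :=
  ∀ i j : Fin n, (InSameBlock p i j ↔ InSameBlock c i.succ j.succ)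

/-- `level p l` is `T(p, l)`: the set of partitions of `[n+l]` at the `l`-th level of
the subtree rooted at `p` in the tree of partitions. -/
def level {n : ℕ} (p : SetPartition n) : (l : ℕ) → Set (SetPartition (n + l))
  | 0 => {p}
  | l + 1 => {c | ∃ q ∈ level p l, IsChild c q}

/-- The statistic `s_{α,β}(p) = cr(p)·α + ne(p)·β`. -/
noncomputable def statS {G : Type*} [AddCommGroup G] (α β : G) {n : ℕ} (p : SetPartition n) : G :=
  cr p • α + ne' p • β

/-- The minimum of a block, as a natural number (`0` for the empty set). -/
noncomputable def minOfBlock {n : ℕ} (B : Finset (Fin n)) : ℕ :=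
  sInf (Fin.val '' (B : Set (Fin n)))

/-- The minima of the blocks of `p`, listed in increasing order; its `i`-th entry
(0-indexed) is `b_{i+1}`, the minimum of the block `B_{i+1}`. -/
noncomputable def minsSorted {n : ℕ} (p : SetPartition n) : List ℕ :=
  (p.parts.image fun B => minOfBlock B).sort (· ≤ ·)

open Classical in
/-- The block of `p` containing the element with value `m` (junk if there is none). -/
noncomputable def blockOfNat {n : ℕ} (p : SetPartition n) (m : ℕ) : Finset (Fin n) :=
  (p.parts.filter fun B => ∃ x : Fin n, x ∈ B ∧ (x : ℕ) = m).sup id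

/-- The children `λ⁰, λ¹, …, λᵏ` of a partition `λ` of `[n]`: `childAt p 0 = λ⁰` adds a new
singleton block `{1}`, and for `1 ≤ i ≤ k`, `childAt p i = λⁱ` adds the new element `1`
to the block `B_i` (blocks ordered by increasing minima). It is defined via the setoid
whose classes are the blocks of the child partition. -/
noncomputable def childAt {n : ℕ} (p : SetPartition n) (i : ℕ) : SetPartition (n + 1) := by
  classical
  exact Finpartition.ofSetoid
    (Setoid.ker fun x : Fin (n + 1) =>
      if (x : ℕ) = 0 then
        (if i = 0 then none
         else some (blockOfNat p ((minsSorted p).getD (i - 1) 0)))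
      else some (blockOfNat p ((x : ℕ) - 1)))

theorem isArc_iff {n : ℕ} (p : SetPartition n) (i j : Fin n) :
    IsArc p i j ↔ i < j ∧ p.part i = p.part j ∧
      ∀ x, i < x → x < j → p.part x ≠ p.part i := by
  constructor
  · rintro ⟨hij, B, hB, hi, hj, h⟩
    have hpi := p.part_eq_of_mem hB hi
    refine ⟨hij, by rw [hpi, p.part_eq_of_mem hB hj], fun x h₁ h₂ hx => h x ?_ ⟨h₁, h₂⟩⟩
    rw [← hpi, ← hx]
    exact p.mem_part_self.2 (mem_univ x)
  · rintro ⟨hij, h, h'⟩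
    refine ⟨hij, p.part i, p.part_mem.2 (mem_univ i), p.mem_part_self.2 (mem_univ i),
      h ▸ p.mem_part_self.2 (mem_univ j), fun x hx hxx => h' x hxx.1 hxx.2 ?_⟩
    exact p.part_eq_of_mem (p.part_mem.2 (mem_univ i)) hx

theorem blockOfNat_val {n : ℕ} (p : SetPartition n) (x : Fin n) :
    blockOfNat p x = p.part x := by
  classical
  have h : (p.parts.filter fun B => ∃ y : Fin n, y ∈ B ∧ (y : ℕ) = x) = {p.part x} := by
    ext B
    simp only [mem_filter, mem_singleton]
    constructor
    · rintro ⟨hB, y, hy, hyx⟩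
      obtain rfl := Fin.ext hyx
      exact (p.part_eq_of_mem hB hy).symm
    · rintro rfl
      exact ⟨p.part_mem.2 (mem_univ x), x, p.mem_part_self.2 (mem_univ x), rfl⟩
  unfold blockOfNat
  convert congrArg (fun s : Finset (Finset (Fin n)) => s.sup id) h using 1
  simp

/-- The block label of an element of `childAt p i`: two elements lie in a common block
exactly when their labels agree. -/
noncomputable def childLabel {n : ℕ} (p : SetPartition n) (i : ℕ) (x : Fin (n + 1)) :
    Option (Finset (Fin n)) :=
  if (x : ℕ) = 0 then
    (if i = 0 then none
      else some (blockOfNat p ((minsSorted p).getD (i - 1) 0)))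
  else some (blockOfNat p ((x : ℕ) - 1))

theorem childAt_part_eq_iff {n : ℕ} (p : SetPartition n) (i : ℕ) (x y : Fin (n + 1)) :
    (childAt p i).part x = (childAt p i).part y ↔ childLabel p i x = childLabel p i y := by
  classical
  rw [← Finpartition.mem_part_iff_part_eq_part _ (mem_univ x) (mem_univ y)]
  unfold childAt
  rw [Finpartition.mem_part_ofSetoid_iff_rel]
  exact eq_comm

@[simp]
theorem childLabel_succ {n : ℕ} (p : SetPartition n) (i : ℕ) (x : Fin n) :
    childLabel p i x.succ = some (p.part x) := by
  simp [childLabel, blockOfNat_val]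

theorem isArc_childAt_succ_succ {n : ℕ} (p : SetPartition n) (i : ℕ) (a b : Fin n) :
    IsArc (childAt p i) a.succ b.succ ↔ IsArc p a b := by
  simp only [isArc_iff, ne_eq, childAt_part_eq_iff, Fin.forall_fin_succ, childLabel_succ,
    Fin.succ_lt_succ_iff, Option.some.injEq, Fin.not_lt_zero, false_imp_iff, true_and]

theorem not_isArc_childAt_zero {n : ℕ} (p : SetPartition n) (b : Fin (n + 1)) :
    ¬ IsArc (childAt p 0) 0 b := by
  rw [isArc_iff, childAt_part_eq_iff]
  rintro ⟨h, h', -⟩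
  obtain ⟨c, rfl⟩ := Fin.exists_succ_eq.2 h.ne'
  simp [childLabel] at h'

/-- The arcs of a set partition of `{0, …, n - 1}`, as pairs of natural numbers. -/
noncomputable def arcs {n : ℕ} (p : SetPartition n) : Finset (ℕ × ℕ) := by
  classical
  exact (univ.filter fun e : Fin n × Fin n => IsArc p e.1 e.2).image
    (Prod.map Fin.val Fin.val)

theorem mem_arcs {n : ℕ} (p : SetPartition n) (e : ℕ × ℕ) :
    e ∈ arcs p ↔ ∃ a b : Fin n, IsArc p a b ∧ (a : ℕ) = e.1 ∧ (b : ℕ) = e.2 := by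
  simp [arcs, Prod.ext_iff]

theorem mk_val_mem_arcs {n : ℕ} (p : SetPartition n) (a b : Fin n) :
    ((a : ℕ), (b : ℕ)) ∈ arcs p ↔ IsArc p a b := by
  rw [mem_arcs]
  constructor
  · rintro ⟨a', b', h, ha, hb⟩
    rwa [← Fin.ext ha, ← Fin.ext hb]
  · exact fun h => ⟨a, b, h, rfl, rfl⟩

theorem exists_mem_minOfBlock_eq {n : ℕ} {B : Finset (Fin n)} (hB : B.Nonempty) :
    ∃ x ∈ B, (x : ℕ) = minOfBlock B :=
  Nat.sInf_mem (s := Fin.val '' (B : Set (Fin n))) (by simpa using hB)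

theorem minOfBlock_le {n : ℕ} {B : Finset (Fin n)} {x : Fin n} (hx : x ∈ B) :
    minOfBlock B ≤ x :=
  Nat.sInf_le ⟨x, hx, rfl⟩

theorem val_mem_minsSorted_iff {n : ℕ} (p : SetPartition n) (x : Fin n) :
    (x : ℕ) ∈ minsSorted p ↔ ∀ y < x, p.part y ≠ p.part x := by
  simp only [minsSorted, mem_sort, mem_image]
  constructor
  · rintro ⟨B, hB, hBx⟩ y hyx hy
    obtain ⟨z, hz, hzB⟩ := exists_mem_minOfBlock_eq (p.nonempty_of_mem_parts hB)
    obtain rfl : z = x := Fin.ext (hzB.trans hBx)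
    rw [p.part_eq_of_mem hB hz] at hy
    have := minOfBlock_le (hy ▸ p.mem_part_self.2 (mem_univ y))
    omega
  · intro h
    refine ⟨p.part x, p.part_mem.2 (mem_univ x), ?_⟩
    obtain ⟨z, hz, hzB⟩ := exists_mem_minOfBlock_eq (p.part_nonempty.2 (mem_univ x))
    have hle := minOfBlock_le (p.mem_part_self.2 (mem_univ x))
    by_contra hne
    exact h z (by omega) (p.part_eq_of_mem (p.part_mem.2 (mem_univ x)) hz)

theorem lt_of_mem_minsSorted {n : ℕ} {p : SetPartition n} {x : ℕ} (hx : x ∈ minsSorted p) :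
    x < n := by
  simp only [minsSorted, mem_sort, mem_image] at hx
  obtain ⟨B, hB, rfl⟩ := hx
  obtain ⟨z, -, hz⟩ := exists_mem_minOfBlock_eq (p.nonempty_of_mem_parts hB)
  omega

theorem mem_minsSorted_iff {n : ℕ} (p : SetPartition n) (x : ℕ) :
    x ∈ minsSorted p ↔ x < n ∧ ∀ e ∈ arcs p, e.2 ≠ x := by
  constructor
  · intro h
    refine ⟨lt_of_mem_minsSorted h, fun e he hex => ?_⟩
    obtain ⟨a, b, hab, -, hb⟩ := (mem_arcs p e).1 he
    obtain rfl := hb.trans hex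
    rw [isArc_iff] at hab
    exact (val_mem_minsSorted_iff p b).1 h a hab.1 hab.2.1
  · rintro ⟨hx, h⟩
    lift x to Fin n using hx
    rw [val_mem_minsSorted_iff]
    intro y hy hyx
    classical
    have hne : (univ.filter fun z => z < x ∧ p.part z = p.part x).Nonempty :=
      ⟨y, by simp [hy, hyx]⟩
    obtain ⟨z, hz, hmax⟩ := exists_max_image _ id hne
    simp only [mem_filter, mem_univ, true_and, id] at hz hmax
    refine h (z, x) ((mk_val_mem_arcs p z x).2 ((isArc_iff p z x).2 ⟨hz.1, hz.2, ?_⟩)) rfl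
    intro w hzw hwx hw
    exact (hmax w ⟨hwx, hw.trans hz.2⟩).not_gt hzw

theorem length_minsSorted {n : ℕ} (p : SetPartition n) :
    (minsSorted p).length = p.parts.card := by
  rw [minsSorted, length_sort]
  refine card_image_of_injOn fun B hB C hC hBC => ?_
  obtain ⟨x, hx, hxB⟩ := exists_mem_minOfBlock_eq (p.nonempty_of_mem_parts hB)
  obtain ⟨y, hy, hyC⟩ := exists_mem_minOfBlock_eq (p.nonempty_of_mem_parts hC)
  obtain rfl : x = y := Fin.ext (by rw [hxB, hyC]; exact hBC)
  exact p.eq_of_mem_parts hB hC hx hy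

theorem sortedLT_minsSorted {n : ℕ} (p : SetPartition n) : (minsSorted p).SortedLT :=
  sortedLT_sort _

/-- The translation of an arc of a partition to the corresponding arc of its children. -/
def shiftArc (e : ℕ × ℕ) : ℕ × ℕ := (e.1 + 1, e.2 + 1)

theorem shiftArc_injective : Function.Injective shiftArc := by
  rintro ⟨a, b⟩ ⟨c, d⟩ h
  simpa [shiftArc] using h

theorem arcs_childAt_zero {n : ℕ} (p : SetPartition n) :
    arcs (childAt p 0) = (arcs p).image shiftArc := by
  ext ⟨x, y⟩
  simp only [mem_arcs, mem_image]
  constructor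
  · rintro ⟨a, b, hab, rfl, rfl⟩
    obtain rfl | ⟨a, rfl⟩ := Fin.eq_zero_or_eq_succ a
    · exact absurd hab (not_isArc_childAt_zero p b)
    obtain ⟨b, rfl⟩ := Fin.exists_succ_eq.2 (Fin.ne_zero_of_lt hab.1)
    exact ⟨(a, b), ⟨a, b, (isArc_childAt_succ_succ p 0 a b).1 hab, rfl, rfl⟩, by simp [shiftArc]⟩
  · rintro ⟨e, ⟨a, b, hab, ha, hb⟩, h⟩
    simp only [shiftArc, Prod.mk.injEq] at h
    exact ⟨a.succ, b.succ, (isArc_childAt_succ_succ p 0 a b).2 hab, by simp [ha, h.1],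
      by simp [hb, h.2]⟩

/-- The minimum of the `i`-th block of `p`, blocks being numbered from `1` by increasing
minima. -/
noncomputable def blockMin {n : ℕ} (p : SetPartition n) (i : ℕ) : ℕ :=
  (minsSorted p).getD (i - 1) 0

theorem blockMin_eq_getElem {n : ℕ} {p : SetPartition n} {i : ℕ} (hi : 1 ≤ i)
    (hik : i ≤ p.parts.card) :
    blockMin p i = (minsSorted p)[i - 1]'(by rw [length_minsSorted]; omega) :=
  List.getD_eq_getElem _ _ _

theorem blockMin_mem {n : ℕ} {p : SetPartition n} {i : ℕ} (hi : 1 ≤ i)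
    (hik : i ≤ p.parts.card) : blockMin p i ∈ minsSorted p := by
  rw [blockMin_eq_getElem hi hik]
  exact List.getElem_mem _

theorem blockMin_lt_blockMin {n : ℕ} {p : SetPartition n} {i j : ℕ} (hi : 1 ≤ i)
    (hij : i < j) (hj : j ≤ p.parts.card) : blockMin p i < blockMin p j := by
  rw [blockMin_eq_getElem hi (by omega), blockMin_eq_getElem (by omega) hj]
  exact (sortedLT_minsSorted p).strictMono_get (Fin.mk_lt_mk.2 (by omega))

theorem isArc_childAt_zero_succ {n : ℕ} {p : SetPartition n} {i : ℕ} (hi : 1 ≤ i)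
    (hik : i ≤ p.parts.card) (b : Fin n) :
    IsArc (childAt p i) 0 b.succ ↔ (b : ℕ) = blockMin p i := by
  have hmem := blockMin_mem hi hik
  obtain ⟨m, hm⟩ : ∃ m : Fin n, (m : ℕ) = blockMin p i := ⟨⟨_, lt_of_mem_minsSorted hmem⟩, rfl⟩
  have hlabel : childLabel p i 0 = some (p.part m) := by
    have : (minsSorted p).getD (i - 1) 0 = m := hm.symm
    simp only [childLabel, Fin.val_zero, if_true, this, blockOfNat_val]
    rw [if_neg (by omega)]
  rw [← hm, val_mem_minsSorted_iff] at hmem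
  simp only [isArc_iff, ne_eq, childAt_part_eq_iff, Fin.forall_fin_succ, childLabel_succ,
    Fin.succ_lt_succ_iff, Option.some.injEq, hlabel, Fin.succ_pos, true_and, lt_irrefl,
    false_imp_iff, true_imp_iff]
  rw [← hm, Fin.val_inj]
  constructor
  · rintro ⟨h, h'⟩
    rcases lt_trichotomy b m with hlt | heq | hlt
    · exact absurd h.symm (hmem b hlt)
    · exact heq
    · exact absurd rfl (h' m hlt)
  · rintro rfl
    exact ⟨rfl, hmem⟩

theorem arcs_childAt {n : ℕ} {p : SetPartition n} {i : ℕ} (hi : 1 ≤ i)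
    (hik : i ≤ p.parts.card) :
    arcs (childAt p i) = insert (0, blockMin p i + 1) ((arcs p).image shiftArc) := by
  ext ⟨x, y⟩
  simp only [mem_arcs, mem_image, mem_insert, Prod.mk.injEq]
  constructor
  · rintro ⟨a, b, hab, rfl, rfl⟩
    obtain ⟨b, rfl⟩ := Fin.exists_succ_eq.2 (Fin.ne_zero_of_lt hab.1)
    obtain rfl | ⟨a, rfl⟩ := Fin.eq_zero_or_eq_succ a
    · left
      simp [(isArc_childAt_zero_succ hi hik b).1 hab]
    · right
      exact ⟨(a, b), ⟨a, b, (isArc_childAt_succ_succ p i a b).1 hab, rfl, rfl⟩,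
        by simp [shiftArc]⟩
  · rintro (⟨rfl, rfl⟩ | ⟨e, ⟨a, b, hab, ha, hb⟩, h⟩)
    · have hlt := lt_of_mem_minsSorted (blockMin_mem hi hik)
      exact ⟨0, Fin.succ ⟨_, hlt⟩, (isArc_childAt_zero_succ hi hik _).2 rfl, rfl, rfl⟩
    · simp only [shiftArc, Prod.mk.injEq] at h
      exact ⟨a.succ, b.succ, (isArc_childAt_succ_succ p i a b).2 hab, by simp [ha, h.1],
        by simp [hb, h.2]⟩

theorem sortedLT_zero_cons_map_succ {l : List ℕ} (hl : l.SortedLT) :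
    (0 :: l.map (· + 1)).SortedLT := by
  rw [List.sortedLT_iff_pairwise] at hl ⊢
  rw [List.pairwise_cons, List.pairwise_map]
  exact ⟨by simp, hl.imp (by simp)⟩

theorem minsSorted_childAt_zero {n : ℕ} (p : SetPartition n) :
    minsSorted (childAt p 0) = 0 :: (minsSorted p).map (· + 1) := by
  refine (sortedLT_minsSorted _).eq_of_mem_iff
    (sortedLT_zero_cons_map_succ (sortedLT_minsSorted p)) fun x => ?_
  rw [mem_minsSorted_iff, arcs_childAt_zero, forall_mem_image]
  cases x <;> simp [shiftArc, mem_minsSorted_iff]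

theorem minsSorted_childAt {n : ℕ} {p : SetPartition n} {i : ℕ} (hi : 1 ≤ i)
    (hik : i ≤ p.parts.card) :
    minsSorted (childAt p i) = 0 :: ((minsSorted p).eraseIdx (i - 1)).map (· + 1) := by
  have hs := sortedLT_minsSorted p
  have hlen : i - 1 < (minsSorted p).length := by rw [length_minsSorted]; omega
  refine (sortedLT_minsSorted _).eq_of_mem_iff (sortedLT_zero_cons_map_succ
    (hs.pairwise.eraseIdx _).sortedLT) fun x => ?_
  have herase (y : ℕ) :
      y ∈ (minsSorted p).eraseIdx (i - 1) ↔ y ≠ blockMin p i ∧ y ∈ minsSorted p := by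
    rw [← hs.nodup.erase_getElem _ hlen, hs.nodup.mem_erase_iff, blockMin_eq_getElem hi hik]
  rw [mem_minsSorted_iff, arcs_childAt hi hik, forall_mem_insert, forall_mem_image]
  cases x
  · simp [shiftArc]
  · simp only [shiftArc, ne_eq, Nat.add_right_cancel_iff, Nat.add_lt_add_iff_right,
      List.mem_cons, List.mem_map, exists_eq_right, Nat.add_eq_zero_iff, one_ne_zero, and_false,
      false_or, herase, mem_minsSorted_iff]
    rw [eq_comm (a := blockMin p i), and_left_comm]

theorem blockMin_one {n : ℕ} (p : SetPartition n) (hp : 1 ≤ p.parts.card) :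
    blockMin p 1 = 0 := by
  have hn : 0 < n := (Nat.zero_le _).trans_lt (lt_of_mem_minsSorted (blockMin_mem le_rfl hp))
  have h0 : 0 ∈ minsSorted p := by
    have := (val_mem_minsSorted_iff p ⟨0, hn⟩).2
    exact this fun y hy => absurd (Fin.lt_def.1 hy) (Nat.not_lt_zero _)
  obtain ⟨r, hr, hr0⟩ := List.getElem_of_mem h0
  rw [length_minsSorted] at hr
  have hr' : blockMin p (r + 1) = 0 := by
    rw [blockMin_eq_getElem (by omega) (by omega)]; exact hr0
  rcases Nat.eq_zero_or_pos r with rfl | h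
  · exact hr'
  · have := blockMin_lt_blockMin (p := p) le_rfl (by omega : 1 < r + 1) hr
    omega

theorem card_parts_childAt_zero {n : ℕ} (p : SetPartition n) :
    (childAt p 0).parts.card = p.parts.card + 1 := by
  rw [← length_minsSorted, minsSorted_childAt_zero, List.length_cons, List.length_map,
    length_minsSorted]

theorem card_parts_childAt {n : ℕ} {p : SetPartition n} {i : ℕ} (hi : 1 ≤ i)
    (hik : i ≤ p.parts.card) : (childAt p i).parts.card = p.parts.card := by
  rw [← length_minsSorted, minsSorted_childAt hi hik, List.length_cons, List.length_map,
    List.length_eraseIdx_of_lt (by rw [length_minsSorted]; omega), length_minsSorted]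
  omega

theorem blockMin_childAt_zero {n : ℕ} {p : SetPartition n} {j : ℕ} (hj : 2 ≤ j)
    (hjk : j ≤ p.parts.card + 1) : blockMin (childAt p 0) j = blockMin p (j - 1) + 1 := by
  obtain ⟨j, rfl⟩ := Nat.exists_eq_add_of_le' hj
  have : j < (minsSorted p).length := by rw [length_minsSorted]; omega
  simp [blockMin, minsSorted_childAt_zero, this]

theorem blockMin_childAt_of_le {n : ℕ} {p : SetPartition n} {i j : ℕ} (hi : 1 ≤ i)
    (hik : i ≤ p.parts.card) (hj : 2 ≤ j) (hji : j ≤ i) :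
    blockMin (childAt p i) j = blockMin p (j - 1) + 1 := by
  obtain ⟨j, rfl⟩ := Nat.exists_eq_add_of_le' hj
  have : j < (minsSorted p).length := by rw [length_minsSorted]; omega
  have h' : j < i - 1 := by omega
  simp [blockMin, minsSorted_childAt hi hik, this, List.getElem?_eraseIdx, h']

theorem blockMin_childAt_of_lt {n : ℕ} {p : SetPartition n} {i j : ℕ} (hi : 1 ≤ i)
    (hij : i < j) (hjk : j ≤ p.parts.card) :
    blockMin (childAt p i) j = blockMin p j + 1 := by
  obtain ⟨j, rfl⟩ := Nat.exists_eq_add_of_le' (show 2 ≤ j by omega)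
  have : j + 1 < (minsSorted p).length := by rw [length_minsSorted]; omega
  have h' : ¬ j < i - 1 := by omega
  simp [blockMin, minsSorted_childAt hi (by omega : i ≤ p.parts.card), this,
    List.getElem?_eraseIdx, h']

/-- The contribution of the ordered pair of arcs `(e, f)` to `s_{α,β}`. -/
def arcPairWeight {G : Type*} [AddCommGroup G] (α β : G) (e f : ℕ × ℕ) : G :=
  if e.1 < f.1 ∧ f.1 < e.2 ∧ e.2 < f.2 then α
  else if e.1 < f.1 ∧ f.1 < f.2 ∧ f.2 < e.2 then β else 0

section Weights

variable {G : Type*} [AddCommGroup G] (α β : G)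

theorem statS_eq_sum {n : ℕ} (p : SetPartition n) :
    statS α β p = ∑ e ∈ arcs p, ∑ f ∈ arcs p, arcPairWeight α β e f := by
  classical
  have hinj : Function.Injective (Prod.map (Fin.val (n := n)) (Fin.val (n := n))) :=
    Fin.val_injective.prodMap Fin.val_injective
  set A : Finset (Fin n × Fin n) := univ.filter fun e => IsArc p e.1 e.2 with hA
  have harcs : arcs p = A.image (Prod.map Fin.val Fin.val) := by
    ext e; simp [mem_arcs, hA, Prod.ext_iff]
  have hcr : cr p = ((A ×ˢ A).filter fun e => Crossing e.1 e.2).card := by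
    rw [cr, ← Set.ncard_coe_finset]
    congr 1
    ext e
    simp [hA, and_assoc]
  have hne : ne' p = ((A ×ˢ A).filter fun e => Nesting e.1 e.2).card := by
    rw [ne', ← Set.ncard_coe_finset]
    congr 1
    ext e
    simp [hA, and_assoc]
  rw [statS, hcr, hne, ← sum_const, ← sum_const, sum_filter, sum_filter, ← sum_add_distrib,
    sum_product, harcs, sum_image hinj.injOn]
  refine sum_congr rfl fun e _ => ?_
  rw [sum_image hinj.injOn]
  refine sum_congr rfl fun f _ => ?_
  simp only [arcPairWeight, Crossing, Nesting, Prod.map_fst, Prod.map_snd, Fin.lt_def]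
  split_ifs <;> first | omega | simp

/-- The amount by which `s_{α,β}` changes when a new arc from a new minimal element to `m`
is added to the arcs of `p`. -/
noncomputable def newArcWeight {n : ℕ} (p : SetPartition n) (m : ℕ) : G :=
  ∑ f ∈ arcs p, arcPairWeight α β (0, m + 1) (shiftArc f)

@[simp]
theorem arcPairWeight_shiftArc (e f : ℕ × ℕ) :
    arcPairWeight α β (shiftArc e) (shiftArc f) = arcPairWeight α β e f := by
  simp [arcPairWeight, shiftArc]

@[simp]
theorem arcPairWeight_zero_right (e : ℕ × ℕ) (m : ℕ) : arcPairWeight α β e (0, m) = 0 := by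
  simp [arcPairWeight]

theorem newArcWeight_zero {n : ℕ} (p : SetPartition n) : newArcWeight α β p 0 = 0 :=
  sum_eq_zero fun f _ => by simp [arcPairWeight, shiftArc]

theorem zero_mk_notMem_image_shiftArc (s : Finset (ℕ × ℕ)) (m : ℕ) :
    (0, m) ∉ s.image shiftArc := by
  simp [shiftArc]

theorem statS_childAt_zero {n : ℕ} (p : SetPartition n) :
    statS α β (childAt p 0) = statS α β p := by
  simp only [statS_eq_sum, arcs_childAt_zero, sum_image shiftArc_injective.injOn,
    arcPairWeight_shiftArc]

theorem statS_childAt {n : ℕ} {p : SetPartition n} {i : ℕ} (hi : 1 ≤ i)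
    (hik : i ≤ p.parts.card) :
    statS α β (childAt p i) = statS α β p + newArcWeight α β p (blockMin p i) := by
  simp only [statS_eq_sum, arcs_childAt hi hik,
    sum_insert (zero_mk_notMem_image_shiftArc (arcs p) _), sum_image shiftArc_injective.injOn,
    arcPairWeight_shiftArc, arcPairWeight_zero_right, zero_add, newArcWeight]
  exact add_comm _ _

theorem statS_childAt_one {n : ℕ} {p : SetPartition n} (hp : 1 ≤ p.parts.card) :
    statS α β (childAt p 1) = statS α β p := by
  rw [statS_childAt α β le_rfl hp, blockMin_one p hp, newArcWeight_zero, add_zero]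

theorem arcPairWeight_zero_succ_shiftArc (m : ℕ) (f : ℕ × ℕ) :
    arcPairWeight α β (0, m + 1 + 1) (shiftArc (shiftArc f)) =
      arcPairWeight α β (0, m + 1) (shiftArc f) := by
  simp [arcPairWeight, shiftArc]

theorem newArcWeight_childAt_zero {n : ℕ} (p : SetPartition n) (m : ℕ) :
    newArcWeight α β (childAt p 0) (m + 1) = newArcWeight α β p m := by
  simp only [newArcWeight, arcs_childAt_zero, sum_image shiftArc_injective.injOn,
    arcPairWeight_zero_succ_shiftArc]

theorem newArcWeight_childAt {n : ℕ} {p : SetPartition n} {i : ℕ} (hi : 1 ≤ i)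
    (hik : i ≤ p.parts.card) (m : ℕ) :
    newArcWeight α β (childAt p i) (m + 1) =
      (if m < blockMin p i then α else if blockMin p i < m then β else 0) +
        newArcWeight α β p m := by
  simp only [newArcWeight, arcs_childAt hi hik, sum_image shiftArc_injective.injOn,
    sum_insert (zero_mk_notMem_image_shiftArc (arcs p) _), arcPairWeight_zero_succ_shiftArc]
  simp [arcPairWeight, shiftArc]

end Weights

/-- Lemma 2.1. The values of `s_{α,β}` on the grandchildren
`λ^{i,j} = (λ^i)^j` of a partition `λ` of `[n]` with `k ≥ 1` blocks, in terms of its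
values on `λ` and on the children `λ^1, …, λ^k`. -/
theorem statement2 {G : Type*} [AddCommGroup G] (α β : G) {n k : ℕ}
    (p : SetPartition n) (hpk : p.parts.card = k) (hk : 1 ≤ k) :
    (statS α β (childAt (childAt p 0) 0) = statS α β p ∧
     statS α β (childAt (childAt p 0) 1) = statS α β p ∧
     (∀ j : ℕ, 2 ≤ j → j ≤ k + 1 →
        statS α β (childAt (childAt p 0) j) = statS α β (childAt p (j - 1)))) ∧
    (∀ i : ℕ, 1 ≤ i → i ≤ k →
      statS α β (childAt (childAt p i) 0) = statS α β (childAt p i) ∧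
      statS α β (childAt (childAt p i) 1) = statS α β (childAt p i) ∧
      (∀ j : ℕ, 2 ≤ j → j ≤ i →
        statS α β (childAt (childAt p i) j) =
          statS α β (childAt p i) + statS α β (childAt p (j - 1))
            - statS α β (childAt p 1) + α) ∧
      (∀ j : ℕ, i + 1 ≤ j → j ≤ k →
        statS α β (childAt (childAt p i) j) =
          statS α β (childAt p i) + statS α β (childAt p j)
            - statS α β (childAt p 1) + β)) := by
  subst hpk
  have hk0 := card_parts_childAt_zero p
  refine ⟨⟨?_, ?_, fun j hj hjk => ?_⟩, fun i hi hik => ?_⟩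
  · rw [statS_childAt_zero, statS_childAt_zero]
  · rw [statS_childAt_one α β (by omega), statS_childAt_zero]
  · rw [statS_childAt α β (by omega) (by omega), statS_childAt_zero,
      statS_childAt α β (by omega) (by omega), blockMin_childAt_zero hj hjk,
      newArcWeight_childAt_zero]
  have hki := card_parts_childAt hi hik
  refine ⟨statS_childAt_zero α β _, statS_childAt_one α β (by omega), fun j hj hji => ?_,
    fun j hij hjk => ?_⟩
  · have hlt : blockMin p (j - 1) < blockMin p i :=
      blockMin_lt_blockMin (by omega) (by omega) hik
    rw [statS_childAt α β (p := childAt p i) (by omega) (by omega),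
      statS_childAt α β (p := p) (i := j - 1) (by omega) (by omega), statS_childAt_one α β hk,
      blockMin_childAt_of_le hi hik hj hji, newArcWeight_childAt α β hi hik, if_pos hlt]
    abel
  · have hlt : blockMin p i < blockMin p j := blockMin_lt_blockMin hi hij hjk
    rw [statS_childAt α β (p := childAt p i) (by omega) (by omega),
      statS_childAt α β (p := p) (i := j) (by omega) (by omega), statS_childAt_one α β hk,
      blockMin_childAt_of_lt hi hij hjk, newArcWeight_childAt α β hi hik, if_neg hlt.not_gt,
      if_pos hlt]
    abel
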